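/- arXiv:1601.07814 — 2 statements merged into one kernel-verified Lean document; each statement's English description precedes it below -/
import Mathlib

section
/- Let n ≥ 2, J = (−1,1)ⁿ with coordinates y = (y₁, y₂, y₃), y₃ ∈ ℝ^{n−2}. Let U : J → ℝ be C² with U(0, y₂, y₃) = 0 whenever y₂ ≥ 0 and U(y₁, 0, y₃) = 0 whenever y₁ ≥ 0, and set V(y) = H(y₁)H(y₂)U(y), where H = 1_{[0,∞)}. Let B(y) = (β_{jk}(y)) be a real symmetric matrix-valued C¹ function on J with β₁₁ ≡ 0 and β₂₂ ≡ 0, and suppose there is C ≥ 0 such that for all y ∈ J with y₁ > 0 and y₂ > 0: |∑_{j,k} β_{jk}(y)(∂_j∂_k U)(y)| ≤ C(|(∇U)(y)| + |U(y)|). Then the functions W(y) := H(y₁)H(y₂)(∑_{j,k}β_{jk}∂_j∂_kU)(y), H(y₁)H(y₂)(∇U)(y) and V are locally bounded measurable, and for almost every y ∈ J: |W(y)| ≤ C(|H(y₁)H(y₂)(∇U)(y)| + |V(y)|). -/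
open MeasureTheory

/-- The Heaviside function, indicator of `[0,∞)`. -/
noncomputable def Heaviside (t : ℝ) : ℝ := if 0 ≤ t then 1 else 0

/-- **Lemma 3 of the paper**: if moreover `U` satisfies the differential inequality
`|∑ β_{jk}∂_j∂_k U| ≤ C(|∇U| + |U|)` on the quadrant `{y₁>0, y₂>0}`, then the
representatives `W = H(y₁)H(y₂)∑β_{jk}∂_j∂_kU` of `⟨B∂,∂⟩V`, `G = H(y₁)H(y₂)∇U`
of `∇V`, and `V` are locally bounded and measurable on `J`, and
`|W| ≤ C(|G| + |V|)` almost everywhere on `J`. -/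
theorem heaviside_product_differential_inequality
    (n : ℕ) (hn : 2 ≤ n)
    (J : Set (Fin n → ℝ))
    (hJ : J = {y : Fin n → ℝ | ∀ i, y i ∈ Set.Ioo (-1 : ℝ) 1})
    (U : (Fin n → ℝ) → ℝ)
    (hU : ContDiffOn ℝ 2 U J)
    (hU1 : ∀ y ∈ J, y ⟨0, by omega⟩ = 0 → 0 ≤ y ⟨1, by omega⟩ → U y = 0)
    (hU2 : ∀ y ∈ J, y ⟨1, by omega⟩ = 0 → 0 ≤ y ⟨0, by omega⟩ → U y = 0)
    (V : (Fin n → ℝ) → ℝ)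
    (hV : V = fun y => Heaviside (y ⟨0, by omega⟩) * Heaviside (y ⟨1, by omega⟩) * U y)
    (B : (Fin n → ℝ) → Fin n → Fin n → ℝ)
    (hB : ContDiffOn ℝ 1 B J)
    (hBsym : ∀ y ∈ J, ∀ j k, B y j k = B y k j)
    (hB11 : ∀ y ∈ J, B y ⟨0, by omega⟩ ⟨0, by omega⟩ = 0)
    (hB22 : ∀ y ∈ J, B y ⟨1, by omega⟩ ⟨1, by omega⟩ = 0)
    (C : ℝ) (hC : 0 ≤ C)
    (hineq : ∀ y ∈ J, 0 < y ⟨0, by omega⟩ → 0 < y ⟨1, by omega⟩ →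
      |∑ j, ∑ k, B y j k * iteratedFDeriv ℝ 2 U y ![Pi.single j 1, Pi.single k 1]|
        ≤ C * (Real.sqrt (∑ k, (fderiv ℝ U y (Pi.single k 1)) ^ 2) + |U y|))
    (W : (Fin n → ℝ) → ℝ)
    (hW : W = fun y => Heaviside (y ⟨0, by omega⟩) * Heaviside (y ⟨1, by omega⟩) *
      ∑ j, ∑ k, B y j k * iteratedFDeriv ℝ 2 U y ![Pi.single j 1, Pi.single k 1])
    (G : (Fin n → ℝ) → Fin n → ℝ)
    (hG : G = fun y k => Heaviside (y ⟨0, by omega⟩) * Heaviside (y ⟨1, by omega⟩) *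
      fderiv ℝ U y (Pi.single k 1)) :
    (AEStronglyMeasurable W (volume.restrict J)
      ∧ AEStronglyMeasurable G (volume.restrict J)
      ∧ AEStronglyMeasurable V (volume.restrict J))
    ∧ (∀ K : Set (Fin n → ℝ), IsCompact K → K ⊆ J →
        ∃ M : ℝ, ∀ y ∈ K, |W y| ≤ M ∧ (∀ k, |G y k| ≤ M) ∧ |V y| ≤ M)
    ∧ (∀ᵐ y ∂(volume.restrict J),
        |W y| ≤ C * (Real.sqrt (∑ k, (G y k) ^ 2) + |V y|)) := by
  have hJo : IsOpen J := by
    have : J = Set.univ.pi (fun _ : Fin n => Set.Ioo (-1 : ℝ) 1) := by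
      rw [hJ]; ext y; simp only [Set.mem_ofPred_eq, Set.mem_univ_pi]
    rw [this]
    exact isOpen_set_pi Set.finite_univ (fun _ _ => isOpen_Ioo)
  have hJm : MeasurableSet J := hJo.measurableSet
  have hHm : Measurable Heaviside := by
    unfold Heaviside
    exact Measurable.ite measurableSet_Ici measurable_const measurable_const
  have hH1 : ∀ t, |Heaviside t| ≤ 1 := by
    intro t; unfold Heaviside; split_ifs <;> simp
  have hHH : ∀ s t x M : ℝ, |x| ≤ M → |Heaviside s * Heaviside t * x| ≤ M := by
    intro s t x M h
    rw [abs_mul, abs_mul]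
    have h1 : |Heaviside s| * |Heaviside t| ≤ 1 :=
      mul_le_one₀ (hH1 s) (abs_nonneg _) (hH1 t)
    calc _ ≤ 1 * |x| := mul_le_mul_of_nonneg_right h1 (abs_nonneg _)
      _ ≤ M := by rwa [one_mul]
  have hcU : ContinuousOn U J := hU.continuousOn
  have hcD : ∀ k : Fin n, ContinuousOn (fun y => fderiv ℝ U y (Pi.single k 1)) J := fun k =>
    (hU.continuousOn_fderiv_of_isOpen hJo (by norm_num)).clm_apply continuousOn_const
  have hcI : ∀ v : Fin 2 → (Fin n → ℝ),
      ContinuousOn (fun y => iteratedFDeriv ℝ 2 U y v) J := by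
    intro v
    have h := hU.continuousOn_iteratedFDerivWithin (m := 2) (by norm_num) hJo.uniqueDiffOn
    have h2 : ContinuousOn (iteratedFDeriv ℝ 2 U) J :=
      h.congr (fun y hy => (iteratedFDerivWithin_of_isOpen 2 hJo hy).symm)
    exact (ContinuousMultilinearMap.apply ℝ (fun _ : Fin 2 => (Fin n → ℝ)) ℝ v).continuous.comp_continuousOn h2
  have hcB : ∀ j k, ContinuousOn (fun y => B y j k) J := fun j k =>
    continuousOn_pi.1 (continuousOn_pi.1 hB.continuousOn j) k
  have hcS : ContinuousOn (fun y => ∑ j, ∑ k, B y j k *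
      iteratedFDeriv ℝ 2 U y ![Pi.single j 1, Pi.single k 1]) J :=
    continuousOn_finsetSum _ fun j _ => continuousOn_finsetSum _ fun k _ =>
      (hcB j k).mul (hcI _)
  have hHHm : Measurable (fun y : Fin n → ℝ =>
      Heaviside (y ⟨0, by omega⟩) * Heaviside (y ⟨1, by omega⟩)) :=
    (hHm.comp (measurable_pi_apply _)).mul (hHm.comp (measurable_pi_apply _))
  have hmeas : ∀ f : (Fin n → ℝ) → ℝ, ContinuousOn f J → AEStronglyMeasurable
      (fun y => Heaviside (y ⟨0, by omega⟩) * Heaviside (y ⟨1, by omega⟩) * f y)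
      (volume.restrict J) := fun f hf =>
    hHHm.aestronglyMeasurable.mul (hf.aestronglyMeasurable hJm)
  refine ⟨⟨?_, ?_, ?_⟩, ?_, ?_⟩
  · rw [hW]; exact hmeas _ hcS
  · rw [hG]
    refine AEMeasurable.aestronglyMeasurable (aemeasurable_pi_lambda _ fun k => ?_)
    exact (hmeas _ (hcD k)).aemeasurable
  · rw [hV]; exact hmeas _ hcU
  · intro K hK hKJ
    obtain ⟨M1, h1⟩ := hK.exists_bound_of_continuousOn (hcS.mono hKJ)
    obtain ⟨M2, h2⟩ := hK.exists_bound_of_continuousOn (hcU.mono hKJ)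
    have h3 : ∀ k : Fin n, ∃ M, ∀ y ∈ K, ‖fderiv ℝ U y (Pi.single k 1)‖ ≤ M := fun k =>
      hK.exists_bound_of_continuousOn ((hcD k).mono hKJ)
    choose M3 h3 using h3
    refine ⟨|M1| + |M2| + ∑ k, |M3 k|, fun y hy => ?_⟩
    have hs : 0 ≤ ∑ k, |M3 k| := Finset.sum_nonneg fun _ _ => abs_nonneg _
    have a1 := abs_nonneg M1
    have a2 := abs_nonneg M2
    refine ⟨?_, fun k => ?_, ?_⟩
    · rw [hW]
      refine hHH _ _ _ _ ?_
      have := h1 y hy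
      rw [Real.norm_eq_abs] at this
      linarith [le_abs_self M1]
    · rw [hG]
      refine hHH _ _ _ _ ?_
      have := h3 k y hy
      rw [Real.norm_eq_abs] at this
      have hk : |M3 k| ≤ ∑ k, |M3 k| :=
        Finset.single_le_sum (f := fun k => |M3 k|) (fun _ _ => abs_nonneg _) (Finset.mem_univ k)
      linarith [le_abs_self (M3 k)]
    · rw [hV]
      refine hHH _ _ _ _ ?_
      have := h2 y hy
      rw [Real.norm_eq_abs] at this
      linarith [le_abs_self M2]
  · have hne : ∀ i : Fin n, ∀ᵐ y : Fin n → ℝ ∂(volume.restrict J), y i ≠ 0 := by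
      intro i
      refine ae_restrict_of_ae ?_
      rw [ae_iff]
      simpa [volume_pi] using Measure.pi_hyperplane (fun _ : Fin n => (volume : Measure ℝ)) i 0
    filter_upwards [ae_restrict_mem hJm, hne ⟨0, by omega⟩, hne ⟨1, by omega⟩] with y hy h0 h1
    have hnn : 0 ≤ C * (Real.sqrt (∑ k, (G y k) ^ 2) + |V y|) := by positivity
    by_cases p0 : 0 ≤ y ⟨0, by omega⟩
    · by_cases p1 : 0 ≤ y ⟨1, by omega⟩
      · have := hineq y hy (lt_of_le_of_ne p0 (Ne.symm h0)) (lt_of_le_of_ne p1 (Ne.symm h1))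
        simpa only [hW, hG, hV, Heaviside, if_pos p0, if_pos p1, one_mul] using this
      · have hw : W y = 0 := by
          simp only [hW, Heaviside, if_neg p1, mul_zero, zero_mul]
        rw [hw, abs_zero]; exact hnn
    · have hw : W y = 0 := by
        simp only [hW, Heaviside, if_neg p0, zero_mul]
      rw [hw, abs_zero]; exact hnn
end

section
/- Let 𝒰 ⊆ ℝⁿ be open, let Q : 𝒰 → (real symmetric n×n matrices) be C¹, and define p(x,ξ) = ⟨Q(x)ξ, ξ⟩. Let ψ₀, ψ₁ : 𝒰 → ℝ be C² and let x₀ ∈ 𝒰 be a point where: Q(x₀) has signature (n−1,1); ⟨Q(x₀)dψ₁(x₀), dψ₁(x₀)⟩ > 0 > ⟨Q(x₀)dψ₀(x₀), dψ₀(x₀)⟩; ⟨Q(x₀)dψ₁(x₀), dψ₀(x₀)⟩ = 0; and ψ₀(x₀) = 0. Then there exists λ > 0 such that for every ξ on the unit sphere S^{n−1} with p(x₀, ξ) = 0 and H_p(ψ₁ − λψ₀²)(x₀, ξ) = 0, one has H_p²(ψ₁ − λψ₀²)(x₀, ξ) < 0. That is, the oriented hypersurface {ψ₁ − λψ₀²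 = 0} is pseudo-convex at x₀ with respect to the operator with principal symbol p; moreover it is non-characteristic at x₀. -/
/-- The Poisson bracket `{f,g} = ∑_j ∂f/∂ξ_j ∂g/∂x_j − ∂f/∂x_j ∂g/∂ξ_j` of two
functions on phase space `ℝⁿ_x × ℝⁿ_ξ`. -/
noncomputable def poissonBracket {n : ℕ} (f g : (Fin n → ℝ) × (Fin n → ℝ) → ℝ)
    (z : (Fin n → ℝ) × (Fin n → ℝ)) : ℝ :=
  ∑ j, (fderiv ℝ f z ((0 : Fin n → ℝ), Pi.single j 1) *
          fderiv ℝ g z (Pi.single j 1, (0 : Fin n → ℝ))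
      - fderiv ℝ f z (Pi.single j 1, (0 : Fin n → ℝ)) *
          fderiv ℝ g z ((0 : Fin n → ℝ), Pi.single j 1))

lemma lorentz_aux {m : ℕ} (a b : Fin (m+1) → ℝ)
    (haa : ∑ i : Fin (m+1), (if (i : ℕ) < m then (1 : ℝ) else -1) * a i * a i < 0)
    (hab : ∑ i : Fin (m+1), (if (i : ℕ) < m then (1 : ℝ) else -1) * a i * b i = 0)
    (hbb : ∑ i : Fin (m+1), (if (i : ℕ) < m then (1 : ℝ) else -1) * b i * b i = 0) : b = 0 := by
  rw [Fin.sum_univ_castSucc] at haa hab hbb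
  simp at haa hab hbb
  have cs := Finset.sum_mul_sq_le_sq_mul_sq Finset.univ
    (fun i : Fin m => a i.castSucc) (fun i : Fin m => b i.castSucc)
  have e1 : ∑ i : Fin m, a i.castSucc ^ 2 = ∑ i : Fin m, a i.castSucc * a i.castSucc := by
    simp [sq]
  have e2 : ∑ i : Fin m, b i.castSucc ^ 2 = ∑ i : Fin m, b i.castSucc * b i.castSucc := by
    simp [sq]
  rw [e1, e2] at cs
  set A := ∑ i : Fin m, a i.castSucc * a i.castSucc
  set B := ∑ i : Fin m, b i.castSucc * b i.castSucc with hB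
  set C := ∑ i : Fin m, a i.castSucc * b i.castSucc
  have hC : C = a (Fin.last m) * b (Fin.last m) := by linarith
  have hB' : B = b (Fin.last m) * b (Fin.last m) := by linarith
  have hlast : b (Fin.last m) = 0 := by
    by_contra hne
    have : 0 < b (Fin.last m) * b (Fin.last m) := mul_self_pos.mpr hne
    rw [hC, hB'] at cs
    nlinarith
  have hB0 : B = 0 := by rw [hB', hlast]; ring
  rw [hB, Finset.sum_eq_zero_iff_of_nonneg (fun i _ => mul_self_nonneg _)] at hB0
  funext i
  refine Fin.lastCases ?_ (fun i => ?_) i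
  · simpa using hlast
  · simpa using hB0 i (Finset.mem_univ _)

open Matrix in
lemma quad_aux {n : ℕ} (q : Fin n → Fin n → ℝ) (R : Matrix (Fin n) (Fin n) ℝ) (d : Fin n → ℝ)
    (h : Rᵀ * Matrix.of q * R = Matrix.diagonal d) (a b : Fin n → ℝ) :
    ∑ j, ∑ k, q j k * (R *ᵥ a) j * (R *ᵥ b) k = ∑ i, d i * a i * b i := by
  have h1 : (R *ᵥ a) ⬝ᵥ (Matrix.of q *ᵥ (R *ᵥ b)) = a ⬝ᵥ ((Matrix.diagonal d) *ᵥ b) := by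
    rw [← h, ← Matrix.mulVec_mulVec, ← Matrix.mulVec_mulVec, Matrix.dotProduct_mulVec a Rᵀ,
      Matrix.vecMul_transpose]
  have h2 : (R *ᵥ a) ⬝ᵥ (Matrix.of q *ᵥ (R *ᵥ b))
      = ∑ j, ∑ k, q j k * (R *ᵥ a) j * (R *ᵥ b) k := by
    generalize R *ᵥ a = u
    generalize R *ᵥ b = v
    simp only [dotProduct, Matrix.mulVec, Matrix.of_apply, Finset.mul_sum]
    exact Finset.sum_congr rfl fun j _ => Finset.sum_congr rfl fun k _ => by ring
  rw [← h2, h1]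
  simp only [dotProduct, Matrix.mulVec_diagonal]
  exact Finset.sum_congr rfl fun j _ => by ring

open Matrix in
lemma null_aux {n : ℕ} (q : Fin n → Fin n → ℝ)
    (hsig : ∃ R : Matrix (Fin n) (Fin n) ℝ, IsUnit R ∧
        Rᵀ * Matrix.of q * R
          = Matrix.diagonal (fun i : Fin n => if (i : ℕ) < n - 1 then (1 : ℝ) else -1))
    (g ξ : Fin n → ℝ)
    (hg : ∑ j, ∑ k, q j k * g j * g k < 0)
    (hgx : ∑ j, ∑ k, q j k * g j * ξ k = 0)
    (hx : ∑ j, ∑ k, q j k * ξ j * ξ k = 0) : ξ = 0 := by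
  obtain ⟨R, hR, hD⟩ := hsig
  have hdet : IsUnit R.det := (Matrix.isUnit_iff_isUnit_det R).mp hR
  have hinv : ∀ v, R *ᵥ (R⁻¹ *ᵥ v) = v := fun v => by
    rw [Matrix.mulVec_mulVec, Matrix.mul_nonsing_inv _ hdet, Matrix.one_mulVec]
  have Hq := fun a b => quad_aux q R _ hD (R⁻¹ *ᵥ a) (R⁻¹ *ᵥ b)
  simp only [hinv] at Hq
  rw [Hq] at hg hgx hx
  cases n with
  | zero => exact Subsingleton.elim _ _
  | succ m =>
    have := lorentz_aux _ _ hg hgx hx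
    rw [← hinv ξ, this, Matrix.mulVec_zero]

section
variable {n : ℕ} {𝒰 : Set (Fin n → ℝ)} {Q : (Fin n → ℝ) → Fin n → Fin n → ℝ}
  {p : (Fin n → ℝ) × (Fin n → ℝ) → ℝ} {ψ : (Fin n → ℝ) → ℝ}

lemma Q_entry (hQreg : ContDiffOn ℝ 1 Q 𝒰) (j k : Fin n) :
    ContDiffOn ℝ 1 (fun z : (Fin n → ℝ) × (Fin n → ℝ) => Q z.1 j k) (𝒰 ×ˢ Set.univ) := by
  have h := contDiffOn_pi.mp (contDiffOn_pi.mp hQreg j) k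
  exact h.comp contDiff_fst.contDiffOn (fun z hz => hz.1)

lemma coord2 (j : Fin n) (s) :
    ContDiffOn ℝ 1 (fun z : (Fin n → ℝ) × (Fin n → ℝ) => z.2 j) s :=
  ((contDiff_apply ℝ ℝ j).comp contDiff_snd).contDiffOn

lemma p_reg (hQreg : ContDiffOn ℝ 1 Q 𝒰)
    (hp : p = fun z => ∑ j, ∑ k, Q z.1 j k * z.2 j * z.2 k) :
    ContDiffOn ℝ 1 p (𝒰 ×ˢ Set.univ) := by
  rw [hp]
  exact ContDiffOn.sum fun j _ => ContDiffOn.sum fun k _ =>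
    ((Q_entry hQreg j k).mul (coord2 j _)).mul (coord2 k _)

lemma W_open (h𝒰 : IsOpen 𝒰) : IsOpen (𝒰 ×ˢ (Set.univ : Set (Fin n → ℝ))) :=
  h𝒰.prod isOpen_univ

lemma p_dxi (h𝒰 : IsOpen 𝒰) (hQreg : ContDiffOn ℝ 1 Q 𝒰)
    (hp : p = fun z => ∑ j, ∑ k, Q z.1 j k * z.2 j * z.2 k)
    (z : (Fin n → ℝ) × (Fin n → ℝ)) (hz : z.1 ∈ 𝒰) (v : Fin n → ℝ) :
    fderiv ℝ p z (0, v) = ∑ j, ∑ k, (Q z.1 j k * v j * z.2 k + Q z.1 j k * z.2 j * v k) := by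
  have hd : DifferentiableAt ℝ p z :=
    ((p_reg hQreg hp).contDiffAt ((W_open h𝒰).mem_nhds ⟨hz, trivial⟩)).differentiableAt one_ne_zero
  have h1 : HasDerivAt (fun t : ℝ => p (z + t • ((0 : Fin n → ℝ), v))) (fderiv ℝ p z (0, v)) 0 := by
    have hl : HasDerivAt (fun t : ℝ => z + t • ((0 : Fin n → ℝ), v)) ((0 : Fin n → ℝ), v) 0 := by
      simpa using ((hasDerivAt_id (0:ℝ)).smul_const ((0 : Fin n → ℝ), v)).const_add z
    have hd' : HasFDerivAt p (fderiv ℝ p z) (z + (0:ℝ) • ((0 : Fin n → ℝ), v)) := by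
      simpa using hd.hasFDerivAt
    exact hd'.comp_hasDerivAt (0:ℝ) hl
  have hc : ∀ j, HasDerivAt (fun t : ℝ => z.2 j + t * v j) (v j) 0 := fun j => by
    simpa using ((hasDerivAt_id (0:ℝ)).mul_const (v j)).const_add (z.2 j)
  have h2 : HasDerivAt (fun t : ℝ => p (z + t • ((0 : Fin n → ℝ), v)))
      (∑ j, ∑ k, (Q z.1 j k * v j * z.2 k + Q z.1 j k * z.2 j * v k)) 0 := by
    have : (fun t : ℝ => p (z + t • ((0 : Fin n → ℝ), v))) = fun t =>
        ∑ j, ∑ k, Q z.1 j k * (z.2 j + t * v j) * (z.2 k + t * v k) := by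
      funext t; simp [hp]
    rw [this]
    refine HasDerivAt.fun_sum fun j _ => HasDerivAt.fun_sum fun k _ => ?_
    have h3 := ((hc j).const_mul (Q z.1 j k)).fun_mul (hc k)
    simp only [zero_mul, add_zero] at h3
    exact h3
  exact h1.unique h2

lemma fderiv_fst_comp (z v : (Fin n → ℝ) × (Fin n → ℝ))
    (hψ : DifferentiableAt ℝ ψ z.1) :
    fderiv ℝ (fun z : (Fin n → ℝ) × (Fin n → ℝ) => ψ z.1) z v = fderiv ℝ ψ z.1 v.1 := by
  have : HasFDerivAt (fun z : (Fin n → ℝ) × (Fin n → ℝ) => ψ z.1)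
    ((fderiv ℝ ψ z.1).comp (ContinuousLinearMap.fst ℝ _ _)) z :=
    hψ.hasFDerivAt.comp z hasFDerivAt_fst
  rw [this.fderiv]; rfl

lemma pb_eq (z : (Fin n → ℝ) × (Fin n → ℝ))
    (hψ : DifferentiableAt ℝ ψ z.1) :
    poissonBracket p (fun z => ψ z.1) z =
      ∑ j, fderiv ℝ p z (0, Pi.single j 1) * fderiv ℝ ψ z.1 (Pi.single j 1) := by
  simp [poissonBracket, fderiv_fst_comp z _ hψ]

lemma pb_reg (h𝒰 : IsOpen 𝒰) (hQreg : ContDiffOn ℝ 1 Q 𝒰)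
    (hp : p = fun z => ∑ j, ∑ k, Q z.1 j k * z.2 j * z.2 k) (hψ : ContDiffOn ℝ 2 ψ 𝒰) :
    ContDiffOn ℝ 1 (poissonBracket p (fun z => ψ z.1)) (𝒰 ×ˢ Set.univ) := by
  have hd : ∀ x ∈ 𝒰, DifferentiableAt ℝ ψ x := fun x hx =>
    (hψ.contDiffAt (h𝒰.mem_nhds hx)).differentiableAt two_ne_zero
  have hf : ContDiffOn ℝ 1 (fderiv ℝ ψ) 𝒰 := hψ.fderiv_of_isOpen h𝒰 (by norm_num)
  have : ContDiffOn ℝ 1 (fun z : (Fin n → ℝ) × (Fin n → ℝ) =>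
      ∑ i, (∑ j, ∑ k, (Q z.1 j k * (Pi.single i 1 : Fin n → ℝ) j * z.2 k
        + Q z.1 j k * z.2 j * (Pi.single i 1 : Fin n → ℝ) k))
        * fderiv ℝ ψ z.1 (Pi.single i 1)) (𝒰 ×ˢ Set.univ) := by
    refine ContDiffOn.sum fun i _ => ContDiffOn.mul ?_ ?_
    · refine ContDiffOn.sum fun j _ => ContDiffOn.sum fun k _ => ContDiffOn.add ?_ ?_
      · exact ((Q_entry hQreg j k).mul contDiffOn_const).mul (coord2 k _)
      · exact ((Q_entry hQreg j k).mul (coord2 j _)).mul contDiffOn_const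
    · exact (hf.comp contDiff_fst.contDiffOn (fun z hz => hz.1)).clm_apply contDiffOn_const
  refine this.congr fun z hz => ?_
  rw [pb_eq z (hd _ hz.1)]
  exact Finset.sum_congr rfl fun i _ => by rw [p_dxi h𝒰 hQreg hp z hz.1]

lemma pb_cont (h𝒰 : IsOpen 𝒰) {f g : (Fin n → ℝ) × (Fin n → ℝ) → ℝ}
    (hf : ContDiffOn ℝ 1 f (𝒰 ×ˢ Set.univ)) (hg : ContDiffOn ℝ 1 g (𝒰 ×ˢ Set.univ))
    {x₀ : Fin n → ℝ} (hx₀ : x₀ ∈ 𝒰) :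
    Continuous (fun ξ => poissonBracket f g (x₀, ξ)) := by
  have key : ∀ {f : (Fin n → ℝ) × (Fin n → ℝ) → ℝ}, ContDiffOn ℝ 1 f (𝒰 ×ˢ Set.univ) →
      Continuous (fun ξ : Fin n → ℝ => fderiv ℝ f (x₀, ξ)) := fun hf =>
    (hf.continuousOn_fderiv_of_isOpen (W_open h𝒰) le_rfl).comp_continuous
      (by fun_prop) (fun ξ => ⟨hx₀, trivial⟩)
  have h1 := key hf
  have h2 := key hg
  unfold poissonBracket
  fun_prop

end

open Matrix in
/-- **Proposition 2.10 of the paper**: under the conclusions of Lemma 2.6 at a point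
`x₀` (with `Q(x₀)` of signature `(n-1,1)`, `{ψ₁=0}` time-like, `{ψ₀=0}` space-like,
`⟨Qdψ₁,dψ₀⟩ = 0`, `ψ₀(x₀) = 0`), there exists `λ > 0` such that the oriented
hypersurface `{ψ₁ - λψ₀² = 0}` is pseudo-convex at `x₀` with respect to the operator
with principal symbol `p(x,ξ) = ⟨Q(x)ξ,ξ⟩` (`H_p` is the Hamiltonian field, so
`H_pψ = {p,ψ}` and `H_p²ψ = {p,{p,ψ}}`), and is non-characteristic at `x₀`. -/
theorem pseudoconvex_hypersurface_exists
    (n : ℕ)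
    (𝒰 : Set (Fin n → ℝ)) (h𝒰 : IsOpen 𝒰)
    (Q : (Fin n → ℝ) → Fin n → Fin n → ℝ)
    (hQreg : ContDiffOn ℝ 1 Q 𝒰)
    (hQsym : ∀ x ∈ 𝒰, ∀ j k, Q x j k = Q x k j)
    (p : (Fin n → ℝ) × (Fin n → ℝ) → ℝ)
    (hp : p = fun z => ∑ j, ∑ k, Q z.1 j k * z.2 j * z.2 k)
    (ψ₀ ψ₁ : (Fin n → ℝ) → ℝ)
    (hψ₀ : ContDiffOn ℝ 2 ψ₀ 𝒰) (hψ₁ : ContDiffOn ℝ 2 ψ₁ 𝒰)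
    (x₀ : Fin n → ℝ) (hx₀ : x₀ ∈ 𝒰)
    (hsig : ∃ R : Matrix (Fin n) (Fin n) ℝ, IsUnit R ∧
        Rᵀ * Matrix.of (Q x₀) * R
          = Matrix.diagonal (fun i : Fin n => if (i : ℕ) < n - 1 then (1 : ℝ) else -1))
    (g₀ g₁ : Fin n → ℝ)
    (hg₀ : g₀ = fun j => fderiv ℝ ψ₀ x₀ (Pi.single j 1))
    (hg₁ : g₁ = fun j => fderiv ℝ ψ₁ x₀ (Pi.single j 1))
    (htimelike : 0 < ∑ j, ∑ k, Q x₀ j k * g₁ j * g₁ k)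
    (hspacelike : ∑ j, ∑ k, Q x₀ j k * g₀ j * g₀ k < 0)
    (horth : ∑ j, ∑ k, Q x₀ j k * g₁ j * g₀ k = 0)
    (hzero : ψ₀ x₀ = 0) :
    ∃ lam : ℝ, 0 < lam ∧
      (∀ ξ : Fin n → ℝ, (∑ j, ξ j ^ 2 = 1) →
        p (x₀, ξ) = 0 →
        poissonBracket p (fun z => ψ₁ z.1 - lam * (ψ₀ z.1) ^ 2) (x₀, ξ) = 0 →
        poissonBracket p
          (poissonBracket p (fun z => ψ₁ z.1 - lam * (ψ₀ z.1) ^ 2)) (x₀, ξ) < 0)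
      ∧ p (x₀, fun j => fderiv ℝ (fun x => ψ₁ x - lam * (ψ₀ x) ^ 2) x₀ (Pi.single j 1)) ≠ 0 := by
  have hd : ∀ {ψ : (Fin n → ℝ) → ℝ}, ContDiffOn ℝ 2 ψ 𝒰 → ∀ x ∈ 𝒰, DifferentiableAt ℝ ψ x :=
    fun hψ x hx => (hψ.contDiffAt (h𝒰.mem_nhds hx)).differentiableAt two_ne_zero
  have hpr := p_reg hQreg hp
  set L := poissonBracket p (fun z => ψ₁ z.1) with hL
  set A := poissonBracket p (fun z => ψ₀ z.1) with hA
  have hLr : ContDiffOn ℝ 1 L (𝒰 ×ˢ Set.univ) := pb_reg h𝒰 hQreg hp hψ₁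
  have hAr : ContDiffOn ℝ 1 A (𝒰 ×ˢ Set.univ) := pb_reg h𝒰 hQreg hp hψ₀
  have hFc := pb_cont h𝒰 hpr hLr hx₀
  have hmem : ∀ ξ : Fin n → ℝ, (x₀, ξ) ∈ 𝒰 ×ˢ (Set.univ : Set (Fin n → ℝ)) :=
    fun ξ => ⟨hx₀, trivial⟩
  have hAc : Continuous (fun ξ : Fin n → ℝ => A (x₀, ξ)) :=
    hAr.continuousOn.comp_continuous (by fun_prop) hmem
  have hpc : Continuous (fun ξ : Fin n → ℝ => p (x₀, ξ)) :=
    hpr.continuousOn.comp_continuous (by fun_prop) hmem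
  -- derivative of the weight
  have hder : ∀ (lam : ℝ), ∀ x ∈ 𝒰, HasFDerivAt (fun x => ψ₁ x - lam * (ψ₀ x) ^ 2)
      (fderiv ℝ ψ₁ x - (2 * lam * ψ₀ x) • fderiv ℝ ψ₀ x) x := by
    intro lam x hx
    have := (hd hψ₁ x hx).hasFDerivAt.sub (((hd hψ₀ x hx).hasFDerivAt.pow 2).const_mul lam)
    refine this.congr_fderiv ?_
    ext v
    simp
    ring
  have hP1 : ∀ lam : ℝ, ∀ z ∈ 𝒰 ×ˢ (Set.univ : Set (Fin n → ℝ)),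
      poissonBracket p (fun z => ψ₁ z.1 - lam * (ψ₀ z.1) ^ 2) z
        = L z - 2 * lam * ψ₀ z.1 * A z := by
    intro lam z hz
    rw [pb_eq (ψ := fun x => ψ₁ x - lam * (ψ₀ x) ^ 2) z (hder lam _ hz.1).differentiableAt,
      hL, hA, pb_eq z (hd hψ₁ _ hz.1), pb_eq z (hd hψ₀ _ hz.1), (hder lam _ hz.1).fderiv,
      Finset.mul_sum, ← Finset.sum_sub_distrib]
    refine Finset.sum_congr rfl fun j _ => ?_
    simp
    ring
  have hP2 : ∀ lam : ℝ, ∀ ξ : Fin n → ℝ,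
      poissonBracket p (poissonBracket p (fun z => ψ₁ z.1 - lam * (ψ₀ z.1) ^ 2)) (x₀, ξ)
        = poissonBracket p L (x₀, ξ) - 2 * lam * (A (x₀, ξ)) ^ 2 := by
    intro lam ξ
    have hnhds := (W_open h𝒰).mem_nhds (hmem ξ)
    have hLd : HasFDerivAt L (fderiv ℝ L (x₀, ξ)) (x₀, ξ) :=
      ((hLr.contDiffAt hnhds).differentiableAt one_ne_zero).hasFDerivAt
    have hAd : HasFDerivAt A (fderiv ℝ A (x₀, ξ)) (x₀, ξ) :=
      ((hAr.contDiffAt hnhds).differentiableAt one_ne_zero).hasFDerivAt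
    have hψd : HasFDerivAt (fun z : (Fin n → ℝ) × (Fin n → ℝ) => ψ₀ z.1)
        ((fderiv ℝ ψ₀ x₀).comp (ContinuousLinearMap.fst ℝ _ _)) (x₀, ξ) :=
      HasFDerivAt.comp (x₀, ξ) (hd hψ₀ x₀ hx₀).hasFDerivAt hasFDerivAt_fst
    have hG : HasFDerivAt (poissonBracket p (fun z => ψ₁ z.1 - lam * (ψ₀ z.1) ^ 2))
        (fderiv ℝ L (x₀, ξ) - (2 * lam * A (x₀, ξ)) •
          (fderiv ℝ ψ₀ x₀).comp (ContinuousLinearMap.fst ℝ (Fin n → ℝ) (Fin n → ℝ))) (x₀, ξ) := by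
      have h := hLd.sub ((hψd.const_mul (2 * lam)).mul hAd)
      refine (h.congr_fderiv ?_).congr_of_eventuallyEq ?_
      · ext v <;> simp [hzero] <;> ring
      · filter_upwards [hnhds] with z hz
        rw [hP1 lam z hz]; rfl
    have hAe : A (x₀, ξ) = ∑ j, fderiv ℝ p (x₀, ξ) (0, Pi.single j 1)
        * fderiv ℝ ψ₀ x₀ (Pi.single j 1) := by
      rw [hA, pb_eq _ (hd hψ₀ x₀ hx₀)]
    have hsq : 2 * lam * (A (x₀, ξ)) ^ 2 = ∑ j, 2 * lam * A (x₀, ξ) *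
        (fderiv ℝ p (x₀, ξ) (0, Pi.single j 1) * fderiv ℝ ψ₀ x₀ (Pi.single j 1)) := by
      rw [← Finset.mul_sum, ← hAe]; ring
    rw [hsq, poissonBracket, poissonBracket, hG.fderiv, ← Finset.sum_sub_distrib]
    refine Finset.sum_congr rfl fun j _ => ?_
    simp
    ring
  -- the compact set
  set K : Set (Fin n → ℝ) := {ξ | ∑ j, ξ j ^ 2 = 1 ∧ p (x₀, ξ) = 0} with hK
  have hKc : IsCompact K := by
    refine Metric.isCompact_of_isClosed_isBounded ?_ ?_
    · exact (isClosed_eq (by fun_prop) continuous_const).inter (isClosed_eq hpc continuous_const)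
    · refine (Metric.isBounded_closedBall (x := (0 : Fin n → ℝ)) (r := 1)).subset ?_
      rintro ξ ⟨h1, -⟩
      rw [mem_closedBall_zero_iff, pi_norm_le_iff_of_nonneg zero_le_one]
      intro i
      have := Finset.single_le_sum (f := fun j => ξ j ^ 2) (fun j _ => sq_nonneg _)
        (Finset.mem_univ i)
      rw [Real.norm_eq_abs]
      exact abs_le_one_iff_mul_self_le_one.mpr (by nlinarith)
  have hAne : ∀ ξ ∈ K, A (x₀, ξ) ≠ 0 := by
    rintro ξ ⟨h1, h2⟩ h0
    have hAv : A (x₀, ξ) = 2 * ∑ j, ∑ k, Q x₀ j k * g₀ j * ξ k := by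
      rw [hA, pb_eq _ (hd hψ₀ x₀ hx₀)]
      have hlin : ∑ j, fderiv ℝ p (x₀, ξ) (0, Pi.single j 1) * fderiv ℝ ψ₀ x₀ (Pi.single j 1)
          = fderiv ℝ p (x₀, ξ) (0, g₀) := by
        have : ((0 : Fin n → ℝ), g₀) = ∑ j, g₀ j • ((0 : Fin n → ℝ), (Pi.single j 1 : Fin n → ℝ)) := by
          refine Prod.ext ?_ ?_
          · simp [Prod.fst_sum]
          · rw [Prod.snd_sum]
            exact pi_eq_sum_univ' g₀
        rw [this, map_sum]
        refine Finset.sum_congr rfl fun j _ => ?_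
        rw [map_smul, smul_eq_mul, hg₀, mul_comm]
      simp only [] at hlin ⊢
      rw [hlin, p_dxi h𝒰 hQreg hp _ hx₀]
      simp only [Finset.sum_add_distrib]
      rw [two_mul]
      congr 1
      rw [Finset.sum_comm]
      refine Finset.sum_congr rfl fun j _ => Finset.sum_congr rfl fun k _ => ?_
      rw [hQsym x₀ hx₀ k j]; ring
    have hz := null_aux (Q x₀) hsig g₀ ξ hspacelike (by linarith) (by simpa [hp] using h2)
    simp [hz] at h1
  obtain ⟨M, hM⟩ := hKc.bddAbove_image (f := fun ξ => poissonBracket p L (x₀, ξ) / (A (x₀, ξ)) ^ 2)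
    (hFc.continuousOn.div (hAc.pow 2).continuousOn (fun ξ hξ => pow_ne_zero 2 (hAne ξ hξ)))
  refine ⟨|M| + 1, by positivity, ?_, ?_⟩
  · intro ξ h1 h2 _
    have hξ : ξ ∈ K := ⟨h1, h2⟩
    rw [hP2]
    have hpos : 0 < (A (x₀, ξ)) ^ 2 := by have := hAne ξ hξ; positivity
    have h3 : poissonBracket p L (x₀, ξ) / (A (x₀, ξ)) ^ 2 ≤ M := hM ⟨ξ, hξ, rfl⟩
    rw [div_le_iff₀ hpos] at h3
    have h4 := le_abs_self M
    have h5 := abs_nonneg M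
    nlinarith
  · rw [(hder _ x₀ hx₀).fderiv, hzero]
    have : p (x₀, g₁) ≠ 0 := by rw [hp]; exact htimelike.ne'
    simpa [hg₁] using this
end
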